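/- Let k, m be positive integers with 1 ≤ k ≤ m − 1 and m ≥ 2, set b = k/m, and let x ∈ (0,b). Then, as n → ∞, √(2π·n·m·b·(1−b)) · exp(n·m·r(x,b)) · (nm choose nk) · x^{nk} (1−x)^{n(m−k)} tends to 1. Equivalently, the probability P(S_{nm}(x) = nk) = (nm choose nk) x^{nk}(1−x)^{n(m−k)} is asymptotically equivalent to exp(−n·m·r(x,b))/√(2π·n·m·b·(1−b)), so that the exponential rate r(x,b) in the local approximation theorem for Bernstein polynomials of locally constant functions is best possible. -/

import Mathlib

open Finset Real Filter Topology

/-- Kullback-Leibler divergence between Bernoulli parameters `x` and `θ`. -/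
noncomputable def klBern (x θ : ℝ) : ℝ :=
  θ * Real.log (θ / x) + (1 - θ) * Real.log ((1 - θ) / (1 - x))

theorem fact_eq_stirling (n : ℕ) (hn : n ≠ 0) :
    (n.factorial : ℝ) = Stirling.stirlingSeq n * (√(2 * n) * (n / Real.exp 1) ^ n) := by
  have : (0:ℝ) < n := by positivity
  unfold Stirling.stirlingSeq
  field_simp

theorem key_eq (k l n : ℕ) (hk : 0 < k) (hl : 0 < l) (hn : 0 < n) (x : ℝ) (hx0 : 0 < x)
    (hx1 : x < 1) :
    Real.sqrt (2 * Real.pi * n * (k + l : ℕ) * ((k : ℝ) / (k + l : ℕ)) *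
        (1 - (k : ℝ) / (k + l : ℕ))) *
      Real.exp ((n : ℝ) * (k + l : ℕ) * klBern x ((k : ℝ) / (k + l : ℕ))) *
      ((n * (k + l)).choose (n * k) : ℝ) * x ^ (n * k) * (1 - x) ^ (n * l) =
    √π * Stirling.stirlingSeq (n * (k + l)) /
      (Stirling.stirlingSeq (n * k) * Stirling.stirlingSeq (n * l)) := by
  have hk' : (0:ℝ) < k := by positivity
  have hl' : (0:ℝ) < l := by positivity
  have hn' : (0:ℝ) < n := by positivity
  have hx1' : 0 < 1 - x := by linarith
  have hb : 1 - (k : ℝ) / (k + l : ℕ) = l / (k + l : ℕ) := by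
    push_cast; field_simp; ring
  have hexp : Real.exp ((n : ℝ) * (k + l : ℕ) * klBern x ((k : ℝ) / (k + l : ℕ))) =
      ((k : ℝ) / (k + l : ℕ) / x) ^ (n * k) * ((l : ℝ) / (k + l : ℕ) / (1 - x)) ^ (n * l) := by
    have e : ∀ (y : ℝ) (j : ℕ), 0 < y → y ^ j = Real.exp (j * Real.log y) := by
      intro y j hy
      rw [Real.exp_nat_mul, Real.exp_log hy]
    rw [e _ (n * k) (by positivity), e _ (n * l) (by positivity), ← Real.exp_add]
    unfold klBern
    rw [hb]
    congr 1
    push_cast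
    field_simp
  have hch : ((n * (k + l)).choose (n * k) : ℝ) =
      (n * (k + l)).factorial / ((n * k).factorial * (n * l).factorial) := by
    rw [mul_add, Nat.cast_add_choose]
  have hS : ∀ j : ℕ, 0 < j → 0 < Stirling.stirlingSeq j := by
    intro j hj
    obtain ⟨i, rfl⟩ := Nat.exists_eq_succ_of_ne_zero hj.ne'
    exact Stirling.stirlingSeq'_pos i
  have s1 := hS (n * k) (by positivity)
  have s2 := hS (n * l) (by positivity)
  have s3 := hS (n * (k + l)) (by positivity)
  have hsq : Real.sqrt (2 * Real.pi * n * (k + l : ℕ) * ((k : ℝ) / (k + l : ℕ)) *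
      ((l : ℝ) / (k + l : ℕ))) * √(2 * (n * (k + l) : ℕ)) =
      √π * (√(2 * (n * k : ℕ)) * √(2 * (n * l : ℕ))) := by
    rw [← Real.sqrt_mul (by positivity), ← Real.sqrt_mul (by positivity),
      ← Real.sqrt_mul (by positivity)]
    congr 1
    push_cast
    field_simp
  have hpw : (((n * (k + l) : ℕ) : ℝ) / Real.exp 1) ^ (n * (k + l)) *
      (((k : ℝ) / (k + l : ℕ) / x) ^ (n * k) * ((l : ℝ) / (k + l : ℕ) / (1 - x)) ^ (n * l)) *
      x ^ (n * k) * (1 - x) ^ (n * l) =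
      (((n * k : ℕ) : ℝ) / Real.exp 1) ^ (n * k) * (((n * l : ℕ) : ℝ) / Real.exp 1) ^ (n * l) := by
    have h1 : (((n * k : ℕ) : ℝ) / Real.exp 1) =
        ((n * (k + l) : ℕ) : ℝ) / Real.exp 1 * ((k : ℝ) / (k + l : ℕ) / x) * x := by
      push_cast; field_simp
    have h2 : (((n * l : ℕ) : ℝ) / Real.exp 1) =
        ((n * (k + l) : ℕ) : ℝ) / Real.exp 1 * ((l : ℝ) / (k + l : ℕ) / (1 - x)) * (1 - x) := by
      push_cast; field_simp
    rw [h1, h2, mul_add n k l, pow_add]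
    simp only [mul_pow _ _ (n * k), mul_pow _ _ (n * l)]
    ring
  rw [hb, hexp, hch, fact_eq_stirling (n * k) (by positivity),
    fact_eq_stirling (n * l) (by positivity), fact_eq_stirling (n * (k + l)) (by positivity)]
  have q1 : 0 < √(2 * ((n * k : ℕ) : ℝ)) := by positivity
  have q2 : 0 < √(2 * ((n * l : ℕ) : ℝ)) := by positivity
  have p1 : 0 < (((n * k : ℕ) : ℝ) / Real.exp 1) ^ (n * k) := by positivity
  have p2 : 0 < (((n * l : ℕ) : ℝ) / Real.exp 1) ^ (n * l) := by positivity
  generalize (((n * k : ℕ) : ℝ) / Real.exp 1) ^ (n * k) = P1 at *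
  generalize (((n * l : ℕ) : ℝ) / Real.exp 1) ^ (n * l) = P2 at *
  generalize (((n * (k + l) : ℕ) : ℝ) / Real.exp 1) ^ (n * (k + l)) = P3 at *
  generalize √(2 * ((n * k : ℕ) : ℝ)) = Q1 at *
  generalize √(2 * ((n * l : ℕ) : ℝ)) = Q2 at *
  generalize √(2 * ((n * (k + l) : ℕ) : ℝ)) = Q3 at *
  generalize Real.sqrt (2 * Real.pi * n * (k + l : ℕ) * ((k : ℝ) / (k + l : ℕ)) *
      ((l : ℝ) / (k + l : ℕ))) = Q at *
  generalize ((k : ℝ) / (k + l : ℕ) / x) ^ (n * k) = A at *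
  generalize ((l : ℝ) / (k + l : ℕ) / (1 - x)) ^ (n * l) = B at *
  generalize x ^ (n * k) = C at *
  generalize (1 - x) ^ (n * l) = D at *
  generalize Stirling.stirlingSeq (n * k) = S1 at *
  generalize Stirling.stirlingSeq (n * l) = S2 at *
  generalize Stirling.stirlingSeq (n * (k + l)) = S3 at *
  calc _ = S3 * (Q * Q3) * (P3 * (A * B) * C * D) / (S1 * S2 * (Q1 * Q2) * (P1 * P2)) := by
        field_simp
    _ = _ := by
        rw [hsq, hpw]
        field_simp

theorem stmt_12 (k m : ℕ) (hk : 1 ≤ k) (hkm : k ≤ m - 1) (hm : 2 ≤ m)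
    (x : ℝ) (hx : x ∈ Set.Ioo (0:ℝ) ((k : ℝ) / m)) :
    Tendsto (fun n : ℕ =>
        Real.sqrt (2 * Real.pi * n * m * ((k : ℝ) / m) * (1 - (k : ℝ) / m)) *
          Real.exp ((n : ℝ) * m * klBern x ((k : ℝ) / m)) *
          ((n * m).choose (n * k) : ℝ) * x ^ (n * k) * (1 - x) ^ (n * (m - k)))
      atTop (𝓝 1) := by
  obtain ⟨l, rfl⟩ := Nat.exists_eq_add_of_le (show k ≤ m by omega)
  have hl : 0 < l := by omega
  have hx1 : x < 1 := by
    refine hx.2.trans_le ?_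
    apply div_le_one_of_le₀
    · push_cast; linarith [(Nat.cast_nonneg l : (0:ℝ) ≤ l)]
    · positivity
  have T : ∀ j : ℕ, 0 < j →
      Tendsto (fun n : ℕ => Stirling.stirlingSeq (n * j)) atTop (𝓝 √π) := fun j hj =>
    Stirling.tendsto_stirlingSeq_sqrt_pi.comp (tendsto_id.atTop_mul_const' hj)
  have hpi : √π ≠ 0 := by positivity
  have L := ((T (k + l) (by omega)).const_mul √π).div ((T k hk).mul (T l hl))
    (mul_ne_zero hpi hpi)
  rw [div_self (mul_ne_zero hpi hpi)] at L
  refine L.congr' ?_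
  filter_upwards [eventually_gt_atTop 0] with n hn
  rw [Nat.add_sub_cancel_left, key_eq k l n hk hl hn x hx.1 hx1]
  rfl
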